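/- arXiv:1506.07501 — 5 statements merged into one kernel-verified Lean document; each statement's English description precedes it below -/
import Mathlib

section
/- Let L ⊆ L′ be first-order languages, let R ∈ L′∖L be an n-ary relation symbol, and let K be a class of L′-structures. Suppose that the class K_L of L-reducts of members of K has, up to isomorphism, only finitely many n-generated substructures and each of them is finite. Then the following are equivalent: (1) there is an open (quantifier-free) L-formula which defines R in K; (2) for all A, B ∈ K, all substructures A₀ of the reduct A_L and B₀ of the reduct B_L, every isomorphism σ : A₀ → B₀, and all a₁,…,aₙ ∈ A₀, if (a₁,…,aₙ) ∈ R^A then (σ(a₁),…,σ(aₙ)) ∈ R^B. -/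
namespace Statement2

open FirstOrder Language Structure

universe u v w

/-- The product `L`-structure on a product of `L`-structures: operations and relations
are computed coordinatewise. -/
def piStructure {L : FirstOrder.Language.{u, v}} {ι : Type*} (M : ι → Type w)
    [S : ∀ i, L.Structure (M i)] : L.Structure (∀ i, M i) where
  funMap f x i := funMap f fun j => x j i
  RelMap r x := ∀ i, RelMap r fun j => x j i

/-- The product `L`-structure on a binary product `A × B` of `L`-structures. -/
def prodStructure {L : FirstOrder.Language.{u, v}} (A : Type w) (B : Type w)
    [L.Structure A] [L.Structure B] : L.Structure (A × B) where
  funMap f x := (funMap f fun j => (x j).1, funMap f fun j => (x j).2)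
  RelMap r x := (RelMap r fun j => (x j).1) ∧ (RelMap r fun j => (x j).2)

variable {L' : FirstOrder.Language.{u, v}}

/-- `ForallPu K P` : the property `P` holds of every member of `P_u(K)`, i.e. of every
ultraproduct of a family of members of the class `K` of `L'`-structures with respect to an
ultrafilter. -/
def ForallPu (K : ∀ M : Type w, L'.Structure M → Prop)
    (P : ∀ A : Type w, L'.Structure A → Prop) : Prop :=
  ∀ (ι : Type w) (u : Ultrafilter ι) (M : ι → Type w) (S : ∀ i, L'.Structure (M i)),
    (∀ i, K (M i) (S i)) →
    letI : ∀ i, L'.Structure (M i) := S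
    P ((u : Filter ι).Product M) inferInstance

/-- `ForallPuPfin K P` : the property `P` holds of every member of `P_u(P_fin(K))`, i.e. of
every ultraproduct (with respect to an ultrafilter) of a family of finite direct products
`A₁ × ⋯ × A_k` (`k ≥ 1`) of members of `K`. -/
def ForallPuPfin (K : ∀ M : Type w, L'.Structure M → Prop)
    (P : ∀ A : Type w, L'.Structure A → Prop) : Prop :=
  ∀ (ι : Type w) (u : Ultrafilter ι) (k : ι → ℕ), (∀ i, 0 < k i) →
    ∀ (N : ∀ i, Fin (k i) → Type w) (S : ∀ i j, L'.Structure (N i j)),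
      (∀ i j, K (N i j) (S i j)) →
      letI : ∀ i, L'.Structure (∀ j, N i j) := fun i => piStructure (N i) (S := S i)
      P ((u : Filter ι).Product fun i => ∀ j, N i j) inferInstance

variable {L : FirstOrder.Language.{u, v}}

/-- A finite conjunction of atomic formulas. -/
inductive IsConjAtomic {α : Type*} {k : ℕ} : L.BoundedFormula α k → Prop
  | of_isAtomic {θ : L.BoundedFormula α k} : θ.IsAtomic → IsConjAtomic θ
  | inf {θ₁ θ₂ : L.BoundedFormula α k} : IsConjAtomic θ₁ → IsConjAtomic θ₂ →
      IsConjAtomic (θ₁ ⊓ θ₂)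

/-- A positive open formula: a finite disjunction of finite conjunctions of atomic
formulas. -/
inductive IsPositiveOpen {α : Type*} {k : ℕ} : L.BoundedFormula α k → Prop
  | of_isConjAtomic {θ : L.BoundedFormula α k} : IsConjAtomic θ → IsPositiveOpen θ
  | sup {θ₁ θ₂ : L.BoundedFormula α k} : IsPositiveOpen θ₁ → IsPositiveOpen θ₂ →
      IsPositiveOpen (θ₁ ⊔ θ₂)

/-- A literal: an atomic or a negated atomic formula. -/
inductive IsLiteral {α : Type*} {k : ℕ} : L.BoundedFormula α k → Prop
  | of_isAtomic {θ : L.BoundedFormula α k} : θ.IsAtomic → IsLiteral θ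
  | not_isAtomic {θ : L.BoundedFormula α k} : θ.IsAtomic → IsLiteral θ.not

/-- A finite conjunction of literals (atomic or negated atomic formulas). -/
inductive IsConjLiteral {α : Type*} {k : ℕ} : L.BoundedFormula α k → Prop
  | of_isLiteral {θ : L.BoundedFormula α k} : IsLiteral θ → IsConjLiteral θ
  | inf {θ₁ θ₂ : L.BoundedFormula α k} : IsConjLiteral θ₁ → IsConjLiteral θ₂ →
      IsConjLiteral (θ₁ ⊓ θ₂)

/-- A Horn clause: a disjunction of atomic and negated atomic formulas containing at most
one non-negated atomic formula (written in the normal form `¬α₁ ∨ ⋯ ∨ ¬α_r ∨ λ` with `λ` a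
literal). -/
inductive IsHornClause {α : Type*} {k : ℕ} : L.BoundedFormula α k → Prop
  | of_isAtomic {θ : L.BoundedFormula α k} : θ.IsAtomic → IsHornClause θ
  | not_isAtomic {θ : L.BoundedFormula α k} : θ.IsAtomic → IsHornClause θ.not
  | sup_not {θ₁ θ₂ : L.BoundedFormula α k} : θ₁.IsAtomic → IsHornClause θ₂ →
      IsHornClause (θ₁.not ⊔ θ₂)

/-- An open Horn formula: a finite conjunction of Horn clauses. -/
inductive IsOpenHorn {α : Type*} {k : ℕ} : L.BoundedFormula α k → Prop
  | of_isHornClause {θ : L.BoundedFormula α k} : IsHornClause θ → IsOpenHorn θ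
  | inf {θ₁ θ₂ : L.BoundedFormula α k} : IsOpenHorn θ₁ → IsOpenHorn θ₂ → IsOpenHorn (θ₁ ⊓ θ₂)

section QuantifierFreeType

variable {α : Type*} {M N : Type*} [L.Structure M] [L.Structure N]

/-- Two tuples have the same quantifier-free type. -/
def SameQFType (L : FirstOrder.Language.{u, v}) {α M N : Type*} [L.Structure M] [L.Structure N]
    (a : α → M) (b : α → N) : Prop :=
  ∀ θ : L.Formula α, BoundedFormula.IsQF θ → (θ.Realize a ↔ θ.Realize b)

theorem isQF_foldr_sup {k : ℕ} {l : List (L.BoundedFormula α k)} (h : ∀ θ ∈ l, θ.IsQF) :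
    (l.foldr (· ⊔ ·) ⊥).IsQF := by
  induction l with
  | nil => exact BoundedFormula.isQF_bot
  | cons θ l ih =>
    exact (h θ (by simp)).sup (ih fun ψ hψ => h ψ (by simp [hψ]))

theorem isQF_foldr_inf {k : ℕ} {l : List (L.BoundedFormula α k)} (h : ∀ θ ∈ l, θ.IsQF) :
    (l.foldr (· ⊓ ·) ⊤).IsQF := by
  induction l with
  | nil => exact BoundedFormula.IsQF.top
  | cons θ l ih =>
    exact (h θ (by simp)).inf (ih fun ψ hψ => h ψ (by simp [hψ]))

theorem isQF_iSup {ι : Type*} [Finite ι] {f : ι → L.Formula α}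
    (h : ∀ i, BoundedFormula.IsQF (f i)) : BoundedFormula.IsQF (Formula.iSup f) := by
  refine isQF_foldr_sup fun θ hθ => ?_
  obtain ⟨i, -, rfl⟩ := List.mem_map.1 hθ
  exact h i

theorem isQF_iInf {ι : Type*} [Finite ι] {f : ι → L.Formula α}
    (h : ∀ i, BoundedFormula.IsQF (f i)) : BoundedFormula.IsQF (Formula.iInf f) := by
  refine isQF_foldr_inf fun θ hθ => ?_
  obtain ⟨i, -, rfl⟩ := List.mem_map.1 hθ
  exact h i

theorem realize_embedding_iff {θ : L.Formula α} (hθ : BoundedFormula.IsQF θ) (f : M ↪[L] N)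
    (a : α → M) : θ.Realize (fun i => f (a i)) ↔ θ.Realize a := by
  have h := hθ.realize_embedding f (v := a) (xs := default)
  rw [Formula.Realize, Formula.Realize, ← h]
  exact iff_of_eq (congrArg _ (Subsingleton.elim _ _))

theorem sameQFType_comp (f : M ↪[L] N) (a : α → M) : SameQFType L a fun i => f (a i) :=
  fun _ hθ => (realize_embedding_iff hθ f a).symm

theorem SameQFType.symm {a : α → M} {b : α → N} (h : SameQFType L a b) : SameQFType L b a :=
  fun θ hθ => (h θ hθ).symm

theorem SameQFType.trans {P : Type*} [L.Structure P] {a : α → M} {b : α → N} {c : α → P}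
    (h : SameQFType L a b) (h' : SameQFType L b c) : SameQFType L a c :=
  fun θ hθ => (h θ hθ).trans (h' θ hθ)

theorem exists_isQF_separating (a : α → M) (b : α → N) :
    ∃ θ : L.Formula α, BoundedFormula.IsQF θ ∧ θ.Realize a ∧
      (θ.Realize b → SameQFType L a b) := by
  by_cases h : SameQFType L a b
  · exact ⟨⊤, BoundedFormula.IsQF.top, id, fun _ => h⟩
  · simp only [SameQFType, not_forall] at h
    obtain ⟨θ, hθ, hne⟩ := h
    by_cases ha : θ.Realize a
    · exact ⟨θ, hθ, ha, fun hb => absurd (iff_of_true ha hb) hne⟩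
    · refine ⟨θ.not, hθ.not, ha, fun hb => absurd (iff_of_false ha ?_) hne⟩
      simpa using hb

/-- In a finite family of pointed structures, every union of quantifier-free types is defined
by a quantifier-free formula. -/
theorem exists_isQF_realize_iff {ι : Type*} [Finite ι] (P : ι → Type*)
    [∀ i, L.Structure (P i)] (p : ∀ i, α → P i) (S : Set ι) :
    ∃ θ : L.Formula α, BoundedFormula.IsQF θ ∧
      ∀ i, θ.Realize (p i) ↔ ∃ j ∈ S, SameQFType L (p j) (p i) := by
  choose ψ hψ hself hsep using fun i j => exists_isQF_separating (L := L) (p i) (p j)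
  refine ⟨Formula.iSup fun j : S => Formula.iInf fun i => ψ j i,
    isQF_iSup fun j => isQF_iInf fun i => hψ j i, fun i => ?_⟩
  simp only [Formula.realize_iSup, Formula.realize_iInf]
  constructor
  · rintro ⟨j, hj⟩
    exact ⟨j, j.2, hsep j i (hj i)⟩
  · rintro ⟨j, hj, h⟩
    exact ⟨⟨j, hj⟩, fun k => (h _ (hψ j k)).1 (hself j k)⟩

theorem SameQFType.realize_term_eq_iff {a : α → M} {b : α → N} (h : SameQFType L a b)
    (s t : L.Term α) : s.realize a = t.realize a ↔ s.realize b = t.realize b := by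
  simpa using h (s.equal t) (BoundedFormula.IsAtomic.equal _ _).isQF

theorem SameQFType.relMap_iff {a : α → M} {b : α → N} (h : SameQFType L a b) {k : ℕ}
    (r : L.Relations k) (t : Fin k → L.Term α) :
    RelMap r (fun i => (t i).realize a) ↔ RelMap r fun i => (t i).realize b := by
  simpa using h (r.formula t) (BoundedFormula.IsAtomic.rel _ _).isQF

theorem exists_term_of_mem_closure_range {a : α → M}
    (x : Substructure.closure L (Set.range a)) : ∃ t : L.Term α, t.realize a = x := by
  obtain ⟨t, ht⟩ := Substructure.mem_closure_iff_exists_term.1 x.2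
  choose g hg using fun y : Set.range a => y.2
  refine ⟨t.relabel g, ?_⟩
  rw [Term.realize_relabel, ← ht]
  exact congrArg (fun v => t.realize v) (funext hg)

/-- Tuples with the same quantifier-free type generate isomorphic substructures. -/
theorem SameQFType.exists_equiv {a : α → M} {b : α → N} (h : SameQFType L a b) :
    ∃ σ : Substructure.closure L (Set.range a) ≃[L] Substructure.closure L (Set.range b),
      ∀ i (hi : a i ∈ Substructure.closure L (Set.range a)), (σ ⟨a i, hi⟩ : N) = b i := by
  choose t ht using exists_term_of_mem_closure_range (L := L) (a := a)
  let f (x : Substructure.closure L (Set.range a)) : Substructure.closure L (Set.range b) :=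
    ⟨(t x).realize b, (t x).realize_mem _ fun i => Substructure.subset_closure ⟨i, rfl⟩⟩
  have hf (x : Substructure.closure L (Set.range a)) (s : L.Term α)
      (hs : s.realize a = x) : (f x : N) = s.realize b :=
    (h.realize_term_eq_iff _ _).1 ((ht x).trans hs.symm)
  have hbij : Function.Bijective f := by
    constructor
    · intro x y hxy
      apply Subtype.ext
      rw [← ht x, ← ht y]
      exact (h.realize_term_eq_iff _ _).2 (congrArg Subtype.val hxy)
    · intro y
      obtain ⟨s, hs⟩ := exists_term_of_mem_closure_range y
      exact ⟨⟨s.realize a, s.realize_mem _ fun i => Substructure.subset_closure ⟨i, rfl⟩⟩,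
        Subtype.ext ((hf _ s rfl).trans hs)⟩
  refine ⟨{ Equiv.ofBijective f hbij with
    map_fun' := fun F x => Subtype.ext ?_
    map_rel' := fun r x => ?_ }, fun i hi => hf ⟨a i, hi⟩ (Term.var i) rfl⟩
  · refine hf _ (Term.func F fun i => t (x i)) ?_
    simp only [Term.realize_func, ht]
    rfl
  · have hr := h.relMap_iff r fun i => t (x i)
    simp only [ht] at hr
    exact hr.symm

end QuantifierFreeType

/-- **Definability of relations by open formulas, locally finite case.**  If the class of
`L`-reducts of members of `K` has (up to isomorphism) only finitely many `n`-generated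
substructures, each of them finite, then the ultraproduct operator can be removed. -/
theorem open_definability_of_relations_of_finitely_many_substructures {L L' : FirstOrder.Language.{u, v}} (φ : L →ᴸ L')
    {n : ℕ} (R : L'.Relations n) (K : ∀ M : Type w, L'.Structure M → Prop)
    (hfin : ∃ (k : ℕ) (P : Fin k → Type w) (SP : ∀ j, L.Structure (P j)),
      (∀ j, Finite (P j)) ∧
      ∀ (M : Type w) (iM : L'.Structure M), K M iM →
        ∀ a : Fin n → M,
          letI := iM
          letI : L.Structure M := φ.reduct M
          letI := SP
          ∃ j, Nonempty ((Substructure.closure L (Set.range a)) ≃[L] P j)) :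
    (∃ θ : L.Formula (Fin n), BoundedFormula.IsQF θ ∧
      ∀ (M : Type w) [iM : L'.Structure M], K M iM →
        ∀ a : Fin n → M, (φ.onFormula θ).Realize a ↔ RelMap R a) ↔
    (∀ (A : Type w) (iA : L'.Structure A), K A iA →
      ∀ (B : Type w) (iB : L'.Structure B), K B iB →
        letI := iA
        letI := iB
        letI : L.Structure A := φ.reduct A
        letI : L.Structure B := φ.reduct B
        ∀ (A₀ : L.Substructure A) (B₀ : L.Substructure B)
          (σ : A₀ ≃[L] B₀) (a : Fin n → A₀),
          RelMap R (fun i => (a i : A)) → RelMap R fun i => (σ (a i) : B)) := by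
  obtain ⟨k, P, SP, hP, hcl⟩ := hfin
  constructor
  · rintro ⟨θ, hθ, hdef⟩ A iA hA B iB hB
    let : L.Structure A := φ.reduct A
    let : L.Structure B := φ.reduct B
    intro A₀ B₀ σ a ha
    rw [← hdef A hA, LHom.realize_onFormula] at ha
    rw [← hdef B hB, LHom.realize_onFormula]
    have h : SameQFType L (fun i => (a i : A)) fun i => (σ (a i) : B) :=
      (sameQFType_comp A₀.subtype a).symm.trans
        (sameQFType_comp (B₀.subtype.comp σ.toEmbedding) a)
    exact (h θ hθ).1 ha
  · intro hiso
    have hpt (M : Type w) (iM : L'.Structure M) (hM : K M iM) (a : Fin n → M) :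
        let : L.Structure M := φ.reduct M
        ∃ x : Σ j, Fin n → P j, SameQFType L a x.2 := by
      let : L.Structure M := φ.reduct M
      obtain ⟨j, ⟨e⟩⟩ := hcl M iM hM a
      let a' (i : Fin n) : Substructure.closure L (Set.range a) :=
        ⟨a i, Substructure.subset_closure ⟨i, rfl⟩⟩
      exact ⟨⟨j, fun i => e (a' i)⟩,
        (sameQFType_comp (Substructure.subtype _) a').symm.trans
          (sameQFType_comp e.toEmbedding a')⟩
    obtain ⟨θ, hθ, hreal⟩ := exists_isQF_realize_iff (L := L)
      (fun x : Σ j, Fin n → P j => P x.1) (fun x => x.2)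
      {x | ∃ (M : Type w) (iM : L'.Structure M) (a : Fin n → M),
        let : L.Structure M := φ.reduct M
        K M iM ∧ RelMap R a ∧ SameQFType L a x.2}
    refine ⟨θ, hθ, fun B iB hB b => ?_⟩
    let : L.Structure B := φ.reduct B
    obtain ⟨y, hy⟩ := hpt B iB hB b
    rw [LHom.realize_onFormula, hy θ hθ, hreal]
    constructor
    · rintro ⟨x, ⟨A, iA, a, hA, ha, hax⟩, hxy⟩
      let : L.Structure A := φ.reduct A
      obtain ⟨σ, hσ⟩ := ((hax.trans hxy).trans hy.symm).exists_equiv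
      have := hiso A iA hA B iB hB _ _ σ
        (fun i => ⟨a i, Substructure.subset_closure ⟨i, rfl⟩⟩) ha
      simpa only [hσ] using this
    · exact fun hb => ⟨y, ⟨B, iB, b, hB, hb, hy⟩, fun _ _ => Iff.rfl⟩

end Statement2
end

section
/- Let A and B be structures for a first-order language L. Suppose that for every sentence φ of the form ∃x₁…∃x_k (α₁ ∧ ⋯ ∧ α_r) with each α_i an atomic L-formula, if A ⊨ φ then B ⊨ φ. Then there exist an ultrafilter u on some index set I and a homomorphism from A into the ultrapower Bᴵ/u. -/
namespace Statement9

open FirstOrder Language Structure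

universe u v w

/-- The product `L`-structure on a product of `L`-structures: operations and relations
are computed coordinatewise. -/
def piStructure {L : FirstOrder.Language.{u, v}} {ι : Type*} (M : ι → Type w)
    [S : ∀ i, L.Structure (M i)] : L.Structure (∀ i, M i) where
  funMap f x i := funMap f fun j => x j i
  RelMap r x := ∀ i, RelMap r fun j => x j i

/-- The product `L`-structure on a binary product `A × B` of `L`-structures. -/
def prodStructure {L : FirstOrder.Language.{u, v}} (A : Type w) (B : Type w)
    [L.Structure A] [L.Structure B] : L.Structure (A × B) where
  funMap f x := (funMap f fun j => (x j).1, funMap f fun j => (x j).2)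
  RelMap r x := (RelMap r fun j => (x j).1) ∧ (RelMap r fun j => (x j).2)

variable {L' : FirstOrder.Language.{u, v}}

/-- `ForallPu K P` : the property `P` holds of every member of `P_u(K)`, i.e. of every
ultraproduct of a family of members of the class `K` of `L'`-structures with respect to an
ultrafilter. -/
def ForallPu (K : ∀ M : Type w, L'.Structure M → Prop)
    (P : ∀ A : Type w, L'.Structure A → Prop) : Prop :=
  ∀ (ι : Type w) (u : Ultrafilter ι) (M : ι → Type w) (S : ∀ i, L'.Structure (M i)),
    (∀ i, K (M i) (S i)) →
    letI : ∀ i, L'.Structure (M i) := S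
    P ((u : Filter ι).Product M) inferInstance

/-- `ForallPuPfin K P` : the property `P` holds of every member of `P_u(P_fin(K))`, i.e. of
every ultraproduct (with respect to an ultrafilter) of a family of finite direct products
`A₁ × ⋯ × A_k` (`k ≥ 1`) of members of `K`. -/
def ForallPuPfin (K : ∀ M : Type w, L'.Structure M → Prop)
    (P : ∀ A : Type w, L'.Structure A → Prop) : Prop :=
  ∀ (ι : Type w) (u : Ultrafilter ι) (k : ι → ℕ), (∀ i, 0 < k i) →
    ∀ (N : ∀ i, Fin (k i) → Type w) (S : ∀ i j, L'.Structure (N i j)),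
      (∀ i j, K (N i j) (S i j)) →
      letI : ∀ i, L'.Structure (∀ j, N i j) := fun i => piStructure (N i) (S := S i)
      P ((u : Filter ι).Product fun i => ∀ j, N i j) inferInstance

variable {L : FirstOrder.Language.{u, v}}

/-- A finite conjunction of atomic formulas. -/
inductive IsConjAtomic {α : Type*} {k : ℕ} : L.BoundedFormula α k → Prop
  | of_isAtomic {θ : L.BoundedFormula α k} : θ.IsAtomic → IsConjAtomic θ
  | inf {θ₁ θ₂ : L.BoundedFormula α k} : IsConjAtomic θ₁ → IsConjAtomic θ₂ →
      IsConjAtomic (θ₁ ⊓ θ₂)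

/-- A positive open formula: a finite disjunction of finite conjunctions of atomic
formulas. -/
inductive IsPositiveOpen {α : Type*} {k : ℕ} : L.BoundedFormula α k → Prop
  | of_isConjAtomic {θ : L.BoundedFormula α k} : IsConjAtomic θ → IsPositiveOpen θ
  | sup {θ₁ θ₂ : L.BoundedFormula α k} : IsPositiveOpen θ₁ → IsPositiveOpen θ₂ →
      IsPositiveOpen (θ₁ ⊔ θ₂)

/-- A literal: an atomic or a negated atomic formula. -/
inductive IsLiteral {α : Type*} {k : ℕ} : L.BoundedFormula α k → Prop
  | of_isAtomic {θ : L.BoundedFormula α k} : θ.IsAtomic → IsLiteral θ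
  | not_isAtomic {θ : L.BoundedFormula α k} : θ.IsAtomic → IsLiteral θ.not

/-- A finite conjunction of literals (atomic or negated atomic formulas). -/
inductive IsConjLiteral {α : Type*} {k : ℕ} : L.BoundedFormula α k → Prop
  | of_isLiteral {θ : L.BoundedFormula α k} : IsLiteral θ → IsConjLiteral θ
  | inf {θ₁ θ₂ : L.BoundedFormula α k} : IsConjLiteral θ₁ → IsConjLiteral θ₂ →
      IsConjLiteral (θ₁ ⊓ θ₂)

/-- A Horn clause: a disjunction of atomic and negated atomic formulas containing at most
one non-negated atomic formula (written in the normal form `¬α₁ ∨ ⋯ ∨ ¬α_r ∨ λ` with `λ` a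
literal). -/
inductive IsHornClause {α : Type*} {k : ℕ} : L.BoundedFormula α k → Prop
  | of_isAtomic {θ : L.BoundedFormula α k} : θ.IsAtomic → IsHornClause θ
  | not_isAtomic {θ : L.BoundedFormula α k} : θ.IsAtomic → IsHornClause θ.not
  | sup_not {θ₁ θ₂ : L.BoundedFormula α k} : θ₁.IsAtomic → IsHornClause θ₂ →
      IsHornClause (θ₁.not ⊔ θ₂)

/-- An open Horn formula: a finite conjunction of Horn clauses. -/
inductive IsOpenHorn {α : Type*} {k : ℕ} : L.BoundedFormula α k → Prop
  | of_isHornClause {θ : L.BoundedFormula α k} : IsHornClause θ → IsOpenHorn θ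
  | inf {θ₁ θ₂ : L.BoundedFormula α k} : IsOpenHorn θ₁ → IsOpenHorn θ₂ → IsOpenHorn (θ₁ ⊓ θ₂)

namespace HomUltrapower

/-- The truth of a formula depends only on the values of its free variables. -/
theorem realize_congr {α : Type*} {M : Type*} [L.Structure M] [DecidableEq α]
    (φ : L.Formula α) {v v' : α → M} (hv : ∀ a ∈ φ.freeVarFinset, v a = v' a) :
    φ.Realize v ↔ φ.Realize v' := by
  have h₁ := BoundedFormula.realize_restrictFreeVar (φ := φ) (xs := (default : Fin 0 → M))
    (f := id) (v := fun a => v a) v fun _ => rfl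
  have h₂ := BoundedFormula.realize_restrictFreeVar (φ := φ) (xs := (default : Fin 0 → M))
    (f := id) (v := fun a => v a) v' fun a => hv a a.2
  exact h₁.symm.trans h₂

/-- A nonempty finite family of atomic formulas has a conjunction. -/
theorem exists_isConjAtomic_realize_iff {ι α : Type*} {k : ℕ} {s : Finset ι} (hs : s.Nonempty)
    (Φ : ι → L.BoundedFormula α k) (hΦ : ∀ i, (Φ i).IsAtomic) :
    ∃ ψ : L.BoundedFormula α k, IsConjAtomic ψ ∧
      ∀ (M : Type w) [L.Structure M] (v : α → M) (xs : Fin k → M),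
        ψ.Realize v xs ↔ ∀ i ∈ s, (Φ i).Realize v xs := by
  induction hs using Finset.Nonempty.cons_induction with
  | singleton i => exact ⟨Φ i, .of_isAtomic (hΦ i), by simp⟩
  | cons i s hi _ ih =>
    obtain ⟨ψ, hψ, h⟩ := ih
    exact ⟨Φ i ⊓ ψ, .inf (.of_isAtomic (hΦ i)) hψ, by simp [h]⟩

/-- Every finite subset of a type is fixed pointwise by a self-map factoring through some
`Fin k`. -/
theorem exists_fin_retract {α : Type*} (t : Finset α) :
    ∃ (k : ℕ) (e : Fin k → α) (g : α → Fin k), ∀ a ∈ t, e (g a) = a := by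
  classical
  rcases isEmpty_or_nonempty α with hα | ⟨⟨a₀⟩⟩
  · exact ⟨0, Fin.elim0, isEmptyElim, fun a => isEmptyElim a⟩
  · let e := (insert a₀ t).equivFin
    refine ⟨_, fun j => e.symm j, fun a => if ha : a ∈ insert a₀ t then e ⟨a, ha⟩
      else e ⟨a₀, Finset.mem_insert_self _ _⟩, fun a ha => ?_⟩
    simp [Finset.mem_insert_of_mem ha]

variable {A B : Type w} [L.Structure A] [L.Structure B]

/-- If `B` satisfies all primitive positive sentences true in `A`, then any finite set of
atomic facts of `A` is satisfied in `B` under some valuation. -/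
theorem exists_valuation
    (h : ∀ (k : ℕ) (ψ : L.BoundedFormula Empty k), IsConjAtomic ψ → A ⊨ ψ.exs → B ⊨ ψ.exs)
    (s : Finset {φ : L.Formula A // φ.IsAtomic ∧ φ.Realize id}) :
    ∃ f : A → B, ∀ φ ∈ s, φ.1.Realize f := by
  classical
  rcases s.eq_empty_or_nonempty with rfl | hs
  · rcases isEmpty_or_nonempty A with hA | ⟨⟨a⟩⟩
    · exact ⟨isEmptyElim, by simp⟩
    · have hB : B ⊨ ((&0).bdEqual (&0) : L.BoundedFormula Empty 1).exs :=
        h _ _ (.of_isAtomic (.equal _ _))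
          (BoundedFormula.realize_exs.2 ⟨fun _ => a, by simp⟩)
      obtain ⟨xs, -⟩ := BoundedFormula.realize_exs.1 hB
      exact ⟨fun _ => xs 0, by simp⟩
  · obtain ⟨k, e, g, heg⟩ := exists_fin_retract (s.biUnion fun φ => φ.1.freeVarFinset)
    let Φ (φ : {φ : L.Formula A // φ.IsAtomic ∧ φ.Realize id}) : L.BoundedFormula Empty k :=
      BoundedFormula.relabel (k := 0) (fun a => Sum.inr (g a)) φ.1
    have realize_Φ (M : Type w) [L.Structure M] (φ) (v : Empty → M) (xs : Fin k → M) :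
        (Φ φ).Realize v xs ↔ φ.1.Realize (xs ∘ g) := by
      refine BoundedFormula.realize_relabel.trans ?_
      rw [Formula.Realize, iff_iff_eq]
      congr 1
      exact Subsingleton.elim _ _
    obtain ⟨ψ, hψ, realize_ψ⟩ :=
      exists_isConjAtomic_realize_iff.{u, v, w} hs Φ fun φ => φ.2.1.relabel _
    have hA : A ⊨ ψ.exs := by
      refine BoundedFormula.realize_exs.2 ⟨e, (realize_ψ _ _ _).2 fun φ hφ => ?_⟩
      exact (realize_Φ A φ _ e).2 ((realize_congr φ.1 fun a ha =>
        heg a (Finset.mem_biUnion.2 ⟨φ, hφ, ha⟩)).2 φ.2.2)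
    obtain ⟨xs, hxs⟩ := BoundedFormula.realize_exs.1 (h k ψ hψ hA)
    exact ⟨xs ∘ g, fun φ hφ => (realize_Φ B φ _ xs).1 ((realize_ψ _ _ _).1 hxs φ hφ)⟩

end HomUltrapower

/-- **Lemma (homomorphism into an ultrapower).**  If every sentence of the form
`∃ x₁ … x_k (α₁ ∧ ⋯ ∧ α_r)` (with the `αᵢ` atomic) holding in `A` holds in `B`, then there
is a homomorphism from `A` into an ultrapower of `B`. -/
theorem exists_hom_into_ultrapower {L : FirstOrder.Language.{u, v}}
    (A : Type w) (B : Type w) [L.Structure A] [L.Structure B]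
    (h : ∀ (k : ℕ) (ψ : L.BoundedFormula Empty k), IsConjAtomic ψ →
      A ⊨ ψ.exs → B ⊨ ψ.exs) :
    ∃ (I : Type (max u v w)) (uf : Ultrafilter I),
      Nonempty (A →[L] (uf : Filter I).Product fun _ : I => B) := by
  choose F hF using HomUltrapower.exists_valuation h
  let uf := Ultrafilter.of
    (Filter.atTop : Filter (Finset {φ : L.Formula A // φ.IsAtomic ∧ φ.Realize id}))
  have eventually_realize (φ : L.Formula A) (hφ : φ.IsAtomic) (hA : φ.Realize id) :
      ∀ᶠ s in (uf : Filter _), φ.Realize (F s) := by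
    refine Ultrafilter.of_le _ ?_
    filter_upwards [Filter.eventually_ge_atTop {⟨φ, hφ, hA⟩}] with s hs
    exact hF s ⟨φ, hφ, hA⟩ (hs (Finset.mem_singleton_self _))
  refine ⟨_, uf, ⟨⟨fun a => Quotient.mk _ fun s => F s a, fun {n} f x => ?_,
    fun {n} r x hr => ?_⟩⟩⟩
  · refine Eq.trans ?_ (Ultraproduct.funMap_cast f fun i s => F s (x i)).symm
    refine Quotient.sound ?_
    have := eventually_realize
      ((Term.var (funMap f x)).equal (Term.func f fun i => Term.var (x i)))
      (.equal _ _) (by simp [Formula.realize_equal])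
    filter_upwards [this] with s hs
    simpa [Formula.realize_equal] using hs
  · have := eventually_realize (r.formula fun i => Term.var (x i)) (.rel _ _)
      (by simpa [Formula.realize_rel] using hr)
    refine (relMap_quotient_mk' _ r fun i s => F s (x i)).2 ?_
    filter_upwards [this] with s hs
    simpa [Formula.realize_rel] using hs

end Statement9
end

section
/- Let A and B be structures for a first-order language L. Suppose that for every sentence φ of the form ∃x₁…∃x_k (λ₁ ∧ ⋯ ∧ λ_r) with each λ_i an atomic L-formula or a negated atomic L-formula, if A ⊨ φ then B ⊨ φ. Then there exist an ultrafilter u on some index set I and an embedding of A into the ultrapower Bᴵ/u. -/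
namespace Statement10

open FirstOrder Language Structure

universe u v w

/-- The product `L`-structure on a product of `L`-structures: operations and relations
are computed coordinatewise. -/
def piStructure {L : FirstOrder.Language.{u, v}} {ι : Type*} (M : ι → Type w)
    [S : ∀ i, L.Structure (M i)] : L.Structure (∀ i, M i) where
  funMap f x i := funMap f fun j => x j i
  RelMap r x := ∀ i, RelMap r fun j => x j i

/-- The product `L`-structure on a binary product `A × B` of `L`-structures. -/
def prodStructure {L : FirstOrder.Language.{u, v}} (A : Type w) (B : Type w)
    [L.Structure A] [L.Structure B] : L.Structure (A × B) where
  funMap f x := (funMap f fun j => (x j).1, funMap f fun j => (x j).2)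
  RelMap r x := (RelMap r fun j => (x j).1) ∧ (RelMap r fun j => (x j).2)

variable {L' : FirstOrder.Language.{u, v}}

/-- `ForallPu K P` : the property `P` holds of every member of `P_u(K)`, i.e. of every
ultraproduct of a family of members of the class `K` of `L'`-structures with respect to an
ultrafilter. -/
def ForallPu (K : ∀ M : Type w, L'.Structure M → Prop)
    (P : ∀ A : Type w, L'.Structure A → Prop) : Prop :=
  ∀ (ι : Type w) (u : Ultrafilter ι) (M : ι → Type w) (S : ∀ i, L'.Structure (M i)),
    (∀ i, K (M i) (S i)) →
    letI : ∀ i, L'.Structure (M i) := S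
    P ((u : Filter ι).Product M) inferInstance

/-- `ForallPuPfin K P` : the property `P` holds of every member of `P_u(P_fin(K))`, i.e. of
every ultraproduct (with respect to an ultrafilter) of a family of finite direct products
`A₁ × ⋯ × A_k` (`k ≥ 1`) of members of `K`. -/
def ForallPuPfin (K : ∀ M : Type w, L'.Structure M → Prop)
    (P : ∀ A : Type w, L'.Structure A → Prop) : Prop :=
  ∀ (ι : Type w) (u : Ultrafilter ι) (k : ι → ℕ), (∀ i, 0 < k i) →
    ∀ (N : ∀ i, Fin (k i) → Type w) (S : ∀ i j, L'.Structure (N i j)),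
      (∀ i j, K (N i j) (S i j)) →
      letI : ∀ i, L'.Structure (∀ j, N i j) := fun i => piStructure (N i) (S := S i)
      P ((u : Filter ι).Product fun i => ∀ j, N i j) inferInstance

variable {L : FirstOrder.Language.{u, v}}

/-- A finite conjunction of atomic formulas. -/
inductive IsConjAtomic {α : Type*} {k : ℕ} : L.BoundedFormula α k → Prop
  | of_isAtomic {θ : L.BoundedFormula α k} : θ.IsAtomic → IsConjAtomic θ
  | inf {θ₁ θ₂ : L.BoundedFormula α k} : IsConjAtomic θ₁ → IsConjAtomic θ₂ →
      IsConjAtomic (θ₁ ⊓ θ₂)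

/-- A positive open formula: a finite disjunction of finite conjunctions of atomic
formulas. -/
inductive IsPositiveOpen {α : Type*} {k : ℕ} : L.BoundedFormula α k → Prop
  | of_isConjAtomic {θ : L.BoundedFormula α k} : IsConjAtomic θ → IsPositiveOpen θ
  | sup {θ₁ θ₂ : L.BoundedFormula α k} : IsPositiveOpen θ₁ → IsPositiveOpen θ₂ →
      IsPositiveOpen (θ₁ ⊔ θ₂)

/-- A literal: an atomic or a negated atomic formula. -/
inductive IsLiteral {α : Type*} {k : ℕ} : L.BoundedFormula α k → Prop
  | of_isAtomic {θ : L.BoundedFormula α k} : θ.IsAtomic → IsLiteral θ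
  | not_isAtomic {θ : L.BoundedFormula α k} : θ.IsAtomic → IsLiteral θ.not

/-- A finite conjunction of literals (atomic or negated atomic formulas). -/
inductive IsConjLiteral {α : Type*} {k : ℕ} : L.BoundedFormula α k → Prop
  | of_isLiteral {θ : L.BoundedFormula α k} : IsLiteral θ → IsConjLiteral θ
  | inf {θ₁ θ₂ : L.BoundedFormula α k} : IsConjLiteral θ₁ → IsConjLiteral θ₂ →
      IsConjLiteral (θ₁ ⊓ θ₂)

/-- A Horn clause: a disjunction of atomic and negated atomic formulas containing at most
one non-negated atomic formula (written in the normal form `¬α₁ ∨ ⋯ ∨ ¬α_r ∨ λ` with `λ` a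
literal). -/
inductive IsHornClause {α : Type*} {k : ℕ} : L.BoundedFormula α k → Prop
  | of_isAtomic {θ : L.BoundedFormula α k} : θ.IsAtomic → IsHornClause θ
  | not_isAtomic {θ : L.BoundedFormula α k} : θ.IsAtomic → IsHornClause θ.not
  | sup_not {θ₁ θ₂ : L.BoundedFormula α k} : θ₁.IsAtomic → IsHornClause θ₂ →
      IsHornClause (θ₁.not ⊔ θ₂)

/-- An open Horn formula: a finite conjunction of Horn clauses. -/
inductive IsOpenHorn {α : Type*} {k : ℕ} : L.BoundedFormula α k → Prop
  | of_isHornClause {θ : L.BoundedFormula α k} : IsHornClause θ → IsOpenHorn θ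
  | inf {θ₁ θ₂ : L.BoundedFormula α k} : IsOpenHorn θ₁ → IsOpenHorn θ₂ → IsOpenHorn (θ₁ ⊓ θ₂)

theorem IsLiteral.exists_relabel {n k : ℕ} {θ : L.Formula (Fin n)} (hθ : IsLiteral θ)
    (g : Fin n → Fin k) :
    ∃ θ' : L.BoundedFormula Empty k, IsLiteral θ' ∧
      ∀ (M : Type w) [L.Structure M] (x : Fin k → M),
        θ'.Realize default x ↔ θ.Realize (x ∘ g) := by
  refine ⟨BoundedFormula.relabel (k := 0) (fun j => (Sum.inr (g j) : Empty ⊕ Fin k)) θ, ?_, ?_⟩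
  · cases hθ with
    | of_isAtomic h => exact .of_isAtomic (h.relabel _)
    | not_isAtomic h =>
      rw [BoundedFormula.relabel_not]
      exact .not_isAtomic (h.relabel _)
  · intro M _ x
    rw [BoundedFormula.realize_relabel, Formula.Realize]
    exact iff_of_eq (congrArg₂ _ (by ext; simp) (Subsingleton.elim _ _))

theorem IsConjLiteral.exists_realize_iff_forall_mem {k : ℕ} {D : Type*} {s : Finset D} (hs : s.Nonempty)
    (θ : D → L.BoundedFormula Empty k) (hθ : ∀ d, d ∈ s → IsLiteral (θ d)) :
    ∃ ψ : L.BoundedFormula Empty k, IsConjLiteral ψ ∧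
      ∀ (M : Type w) [L.Structure M] (x : Fin k → M),
        ψ.Realize default x ↔ ∀ d ∈ s, (θ d).Realize default x := by
  induction hs using Finset.Nonempty.cons_induction with
  | singleton d => exact ⟨θ d, .of_isLiteral (hθ d (by simp)), by simp⟩
  | cons d s hd hs ih =>
    obtain ⟨ψ, hψ, hr⟩ := ih fun e he => hθ e (by simp [he])
    refine ⟨θ d ⊓ ψ, .inf (.of_isLiteral (hθ d (by simp))) hψ, fun M _ x => ?_⟩
    rw [BoundedFormula.realize_inf, hr, Finset.forall_mem_cons]

/-- An element of the diagram of `A`: a literal together with a tuple of elements of `A`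
satisfying it. -/
structure DiagramLiteral (L : FirstOrder.Language.{u, v}) (A : Type w) [L.Structure A] where
  arity : ℕ
  formula : L.Formula (Fin arity)
  tuple : Fin arity → A
  isLiteral : IsLiteral formula
  realize : formula.Realize tuple

theorem nonempty_fun_of_conjLiteral {A : Type w} {B : Type w} [L.Structure A] [L.Structure B]
    (h : ∀ (k : ℕ) (ψ : L.BoundedFormula Empty k), IsConjLiteral ψ →
      A ⊨ ψ.exs → B ⊨ ψ.exs) : Nonempty (A → B) := by
  cases isEmpty_or_nonempty A with
  | inl _ => exact ⟨isEmptyElim⟩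
  | inr hA =>
    obtain ⟨a⟩ := hA
    let t : L.Term (Empty ⊕ Fin 1) := Term.var (Sum.inr 0)
    have hB := h 1 (t.bdEqual t) (.of_isLiteral (.of_isAtomic (.equal t t)))
      (BoundedFormula.realize_exs.2 ⟨fun _ => a, by simp⟩)
    obtain ⟨x, -⟩ := BoundedFormula.realize_exs.1 hB
    exact ⟨fun _ => x 0⟩

theorem exists_fun_realize_finset {A : Type w} {B : Type w} [L.Structure A] [L.Structure B]
    (h : ∀ (k : ℕ) (ψ : L.BoundedFormula Empty k), IsConjLiteral ψ →
      A ⊨ ψ.exs → B ⊨ ψ.exs) (s : Finset (DiagramLiteral L A)) :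
    ∃ f : A → B, ∀ d ∈ s, d.formula.Realize (f ∘ d.tuple) := by
  classical
  obtain ⟨f₀⟩ := nonempty_fun_of_conjLiteral h
  obtain rfl | hs := s.eq_empty_or_nonempty
  · exact ⟨f₀, by simp⟩
  let S : Finset A := s.biUnion fun d => Finset.univ.image d.tuple
  have hS : ∀ d ∈ s, ∀ j, d.tuple j ∈ S := fun d hd j =>
    Finset.mem_biUnion.2 ⟨d, hd, Finset.mem_image_of_mem _ (Finset.mem_univ j)⟩
  let e := S.equivFin
  have hθ : ∀ d : s, ∃ θ : L.BoundedFormula Empty S.card, IsLiteral θ ∧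
      ∀ (M : Type w) [L.Structure M] (x : Fin S.card → M),
        θ.Realize default x ↔
          d.1.formula.Realize (x ∘ fun j => e ⟨d.1.tuple j, hS d.1 d.2 j⟩) :=
    fun d => d.1.isLiteral.exists_relabel _
  choose θ hlit hreal using hθ
  obtain ⟨ψ, hψ, hψr⟩ := IsConjLiteral.exists_realize_iff_forall_mem.{u, v, w}
    (s := s.attach) (by simpa using hs) θ fun d _ => hlit d
  have hB := h _ ψ hψ <| BoundedFormula.realize_exs.2 ⟨fun m => (e.symm m).1, by
    refine (hψr A _).2 fun d _ => (hreal d A _).2 ?_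
    convert d.1.realize
    ext j
    simp⟩
  obtain ⟨x, hx⟩ := BoundedFormula.realize_exs.1 hB
  refine ⟨fun a => if ha : a ∈ S then x (e ⟨a, ha⟩) else f₀ a, fun d hd => ?_⟩
  convert (hreal ⟨d, hd⟩ B x).1 ((hψr B x).1 hx ⟨d, hd⟩ (Finset.mem_attach _ _)) using 1
  ext j
  simp [hS d hd j]

/-- **Lemma (embedding into an ultrapower).**  If every sentence of the form
`∃ x₁ … x_k (λ₁ ∧ ⋯ ∧ λ_r)` (with the `λᵢ` atomic or negated atomic) holding in `A` holds
in `B`, then there is an embedding of `A` into an ultrapower of `B`. -/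
theorem exists_embedding_into_ultrapower {L : FirstOrder.Language.{u, v}}
    (A : Type w) (B : Type w) [L.Structure A] [L.Structure B]
    (h : ∀ (k : ℕ) (ψ : L.BoundedFormula Empty k), IsConjLiteral ψ →
      A ⊨ ψ.exs → B ⊨ ψ.exs) :
    ∃ (I : Type (max u v w)) (uf : Ultrafilter I),
      Nonempty (A ↪[L] (uf : Filter I).Product fun _ : I => B) := by
  choose f hf using exists_fun_realize_finset h
  let uf : Ultrafilter (Finset (DiagramLiteral L A)) := Ultrafilter.of Filter.atTop
  have key : ∀ {n : ℕ} {θ : L.Formula (Fin n)}, IsLiteral θ → ∀ a : Fin n → A, θ.Realize a →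
      ∀ᶠ s in (uf : Filter _), θ.Realize (f s ∘ a) := by
    intro n θ hθ a ha
    filter_upwards [Ultrafilter.of_le _ (Filter.eventually_ge_atTop {⟨n, θ, a, hθ, ha⟩})]
      with s hs
    exact hf s _ (Finset.singleton_subset_iff.1 hs)
  refine ⟨_, uf, ⟨⟨⟨fun a => Quotient.mk _ fun s => f s a, fun a b hab => ?_⟩, ?_, ?_⟩⟩⟩
  · by_contra hne
    let θ : L.Formula (Fin 2) := (Term.var 0 : L.Term (Fin 2)).equal (Term.var 1)
    have hθ := key (θ := θ.not) (.not_isAtomic (.equal _ _)) ![a, b] (by simpa [θ] using hne)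
    obtain ⟨s, hs, hs'⟩ := (hθ.and (Quotient.exact hab)).exists
    exact absurd hs' (by simpa [θ] using hs)
  · intro n F x
    refine Eq.trans (Quotient.sound ?_) (Ultraproduct.funMap_cast F fun i s => f s (x i)).symm
    let θ : L.Formula (Fin (n + 1)) :=
      (Term.var 0 : L.Term (Fin (n + 1))).equal (Term.func F fun i => Term.var i.succ)
    filter_upwards [key (θ := θ) (.of_isAtomic (.equal _ _)) (Fin.cons (funMap F x) x)
      (by simp [θ])] with s hs
    simpa [θ, Function.comp_def] using hs
  · intro n R x
    let θ : L.Formula (Fin n) := R.formula fun i => Term.var i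
    have hR : RelMap R (fun i => (Quotient.mk _ (fun s => f s (x i)) :
        (uf : Filter _).Product fun _ => B)) ↔ ∀ᶠ s in (uf : Filter _), RelMap R (f s ∘ x) :=
      relMap_quotient_mk' _ _ _
    refine hR.trans ⟨fun hs => ?_, fun hx => ?_⟩
    · by_contra hx
      have hθ := key (θ := θ.not) (.not_isAtomic (.rel _ _)) x (by simpa [θ] using hx)
      obtain ⟨s, h₁, h₂⟩ := (hθ.and hs).exists
      exact absurd h₂ (by simpa [θ, Function.comp_def] using h₁)
    · filter_upwards [key (θ := θ) (.of_isAtomic (.rel _ _)) x (by simpa [θ] using hx)] with s hs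
      simpa [θ, Function.comp_def] using hs

end Statement10
end

section
/- Let K be a class of algebras in an algebraic first-order language L, contained in a locally finite variety. Let A ↦ f^A be a map assigning to each A ∈ K an n-ary operation f^A : Aⁿ → A. Suppose that for every m ∈ ℕ, all A₁,…,A_m ∈ K, and every subalgebra S ≤ A₁ × ⋯ × A_m, the underlying set of S is closed under the operation f^{A₁} × ⋯ × f^{A_m} (defined coordinatewise). Then there is an L-term t(x₁,…,xₙ) such that t^A = f^A for every A ∈ K. -/
namespace Statement18

open FirstOrder Language Structure

universe u v w

/-- The product `L`-structure on a product of `L`-structures: operations and relations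
are computed coordinatewise. -/
def piStructure {L : FirstOrder.Language.{u, v}} {ι : Type*} (M : ι → Type w)
    [S : ∀ i, L.Structure (M i)] : L.Structure (∀ i, M i) where
  funMap f x i := funMap f fun j => x j i
  RelMap r x := ∀ i, RelMap r fun j => x j i

/-- The product `L`-structure on a binary product `A × B` of `L`-structures. -/
def prodStructure {L : FirstOrder.Language.{u, v}} (A : Type w) (B : Type w)
    [L.Structure A] [L.Structure B] : L.Structure (A × B) where
  funMap f x := (funMap f fun j => (x j).1, funMap f fun j => (x j).2)
  RelMap r x := (RelMap r fun j => (x j).1) ∧ (RelMap r fun j => (x j).2)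

variable {L' : FirstOrder.Language.{u, v}}

/-- `ForallPu K P` : the property `P` holds of every member of `P_u(K)`, i.e. of every
ultraproduct of a family of members of the class `K` of `L'`-structures with respect to an
ultrafilter. -/
def ForallPu (K : ∀ M : Type w, L'.Structure M → Prop)
    (P : ∀ A : Type w, L'.Structure A → Prop) : Prop :=
  ∀ (ι : Type w) (u : Ultrafilter ι) (M : ι → Type w) (S : ∀ i, L'.Structure (M i)),
    (∀ i, K (M i) (S i)) →
    letI : ∀ i, L'.Structure (M i) := S
    P ((u : Filter ι).Product M) inferInstance

/-- `ForallPuPfin K P` : the property `P` holds of every member of `P_u(P_fin(K))`, i.e. of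
every ultraproduct (with respect to an ultrafilter) of a family of finite direct products
`A₁ × ⋯ × A_k` (`k ≥ 1`) of members of `K`. -/
def ForallPuPfin (K : ∀ M : Type w, L'.Structure M → Prop)
    (P : ∀ A : Type w, L'.Structure A → Prop) : Prop :=
  ∀ (ι : Type w) (u : Ultrafilter ι) (k : ι → ℕ), (∀ i, 0 < k i) →
    ∀ (N : ∀ i, Fin (k i) → Type w) (S : ∀ i j, L'.Structure (N i j)),
      (∀ i j, K (N i j) (S i j)) →
      letI : ∀ i, L'.Structure (∀ j, N i j) := fun i => piStructure (N i) (S := S i)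
      P ((u : Filter ι).Product fun i => ∀ j, N i j) inferInstance

variable {L : FirstOrder.Language.{u, v}}

/-- A finite conjunction of atomic formulas. -/
inductive IsConjAtomic {α : Type*} {k : ℕ} : L.BoundedFormula α k → Prop
  | of_isAtomic {θ : L.BoundedFormula α k} : θ.IsAtomic → IsConjAtomic θ
  | inf {θ₁ θ₂ : L.BoundedFormula α k} : IsConjAtomic θ₁ → IsConjAtomic θ₂ →
      IsConjAtomic (θ₁ ⊓ θ₂)

/-- A positive open formula: a finite disjunction of finite conjunctions of atomic
formulas. -/
inductive IsPositiveOpen {α : Type*} {k : ℕ} : L.BoundedFormula α k → Prop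
  | of_isConjAtomic {θ : L.BoundedFormula α k} : IsConjAtomic θ → IsPositiveOpen θ
  | sup {θ₁ θ₂ : L.BoundedFormula α k} : IsPositiveOpen θ₁ → IsPositiveOpen θ₂ →
      IsPositiveOpen (θ₁ ⊔ θ₂)

/-- A literal: an atomic or a negated atomic formula. -/
inductive IsLiteral {α : Type*} {k : ℕ} : L.BoundedFormula α k → Prop
  | of_isAtomic {θ : L.BoundedFormula α k} : θ.IsAtomic → IsLiteral θ
  | not_isAtomic {θ : L.BoundedFormula α k} : θ.IsAtomic → IsLiteral θ.not

/-- A finite conjunction of literals (atomic or negated atomic formulas). -/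
inductive IsConjLiteral {α : Type*} {k : ℕ} : L.BoundedFormula α k → Prop
  | of_isLiteral {θ : L.BoundedFormula α k} : IsLiteral θ → IsConjLiteral θ
  | inf {θ₁ θ₂ : L.BoundedFormula α k} : IsConjLiteral θ₁ → IsConjLiteral θ₂ →
      IsConjLiteral (θ₁ ⊓ θ₂)

/-- A Horn clause: a disjunction of atomic and negated atomic formulas containing at most
one non-negated atomic formula (written in the normal form `¬α₁ ∨ ⋯ ∨ ¬α_r ∨ λ` with `λ` a
literal). -/
inductive IsHornClause {α : Type*} {k : ℕ} : L.BoundedFormula α k → Prop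
  | of_isAtomic {θ : L.BoundedFormula α k} : θ.IsAtomic → IsHornClause θ
  | not_isAtomic {θ : L.BoundedFormula α k} : θ.IsAtomic → IsHornClause θ.not
  | sup_not {θ₁ θ₂ : L.BoundedFormula α k} : θ₁.IsAtomic → IsHornClause θ₂ →
      IsHornClause (θ₁.not ⊔ θ₂)

/-- An open Horn formula: a finite conjunction of Horn clauses. -/
inductive IsOpenHorn {α : Type*} {k : ℕ} : L.BoundedFormula α k → Prop
  | of_isHornClause {θ : L.BoundedFormula α k} : IsHornClause θ → IsOpenHorn θ
  | inf {θ₁ θ₂ : L.BoundedFormula α k} : IsOpenHorn θ₁ → IsOpenHorn θ₂ → IsOpenHorn (θ₁ ⊓ θ₂)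

/-- Term evaluation in a product structure is coordinatewise. -/
theorem realize_piStructure {L : FirstOrder.Language.{u, v}} {ι : Type*} (M : ι → Type w)
    [S : ∀ i, L.Structure (M i)] {α : Type*} (t : L.Term α) (x : α → ∀ i, M i) (i : ι) :
    let _ : L.Structure (∀ i, M i) := piStructure M
    t.realize x i = t.realize fun a => x a i := by
  let _ : L.Structure (∀ i, M i) := piStructure M
  induction t with
  | var => rfl
  | func g ts ih =>
    change funMap g (fun j => (ts j).realize x i) = funMap g _
    simp only [ih]

/-- An element of the substructure generated by a tuple is the value of a term at that tuple. -/
theorem exists_term_of_mem_closure_range {L : FirstOrder.Language.{u, v}} {M : Type*}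
    [L.Structure M] {α : Type*} {x : α → M} {y : M}
    (hy : y ∈ Substructure.closure L (Set.range x)) :
    ∃ t : L.Term α, t.realize x = y := by
  obtain ⟨t, rfl⟩ := Substructure.mem_closure_iff_exists_term.1 hy
  refine ⟨t.relabel fun z => z.2.choose, ?_⟩
  rw [Term.realize_relabel]
  congr 1
  funext z
  exact z.2.choose_spec

/-- Two terms are equivalent over a class of structures if they induce the same operation in
each of its members. -/
def termSetoid {L : FirstOrder.Language.{u, v}} (K : ∀ M : Type w, L.Structure M → Prop)
    (α : Type*) : Setoid (L.Term α) where
  r t s := ∀ (M : Type w) [iM : L.Structure M], K M iM →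
    ∀ a : α → M, t.realize a = s.realize a
  iseqv :=
    ⟨fun _ _ _ _ _ => rfl, fun h M _ hM a => (h M hM a).symm,
      fun h₁ h₂ M _ hM a => (h₁ M hM a).trans (h₂ M hM a)⟩

/-- A class contained in a locally finite variety has, up to equivalence, only finitely many
terms in finitely many variables. -/
theorem finite_quotient_termSetoid {L : FirstOrder.Language.{u, v}}
    (K : ∀ M : Type w, L.Structure M → Prop)
    (E : Set (Σ k : ℕ, L.Term (Fin k) × L.Term (Fin k)))
    (hKE : ∀ (M : Type w) [iM : L.Structure M], K M iM →
      ∀ e ∈ E, ∀ v : Fin e.1 → M, e.2.1.realize v = e.2.2.realize v)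
    (hfin : ∀ (M : Type w) [iM : L.Structure M],
      (∀ e ∈ E, ∀ v : Fin e.1 → M, e.2.1.realize v = e.2.2.realize v) →
      Structure.FG L M → Finite M)
    (α : Type*) [Finite α] : Finite (Quotient (termSetoid K α)) := by
  by_contra hinf
  rw [not_finite_iff_infinite] at hinf
  let q := Infinite.natEmbedding (Quotient (termSetoid K α))
  have hsep : ∀ p : {p : ℕ × ℕ // p.1 ≠ p.2}, ∃ (M : Type w) (iM : L.Structure M), K M iM ∧
      ∃ a : α → M, (q p.1.1).out.realize a ≠ (q p.1.2).out.realize a := by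
    intro p
    by_contra! h
    exact p.2 (q.injective (Quotient.out_equiv_out.1 fun M iM hM a => h M iM hM a))
  choose M S hK a ha using hsep
  letI : L.Structure (∀ p, M p) := piStructure M
  let x : α → ∀ p, M p := fun j p => a p j
  let C := Substructure.closure L (Set.range x)
  let g : α → C := fun j => ⟨x j, Substructure.subset_closure ⟨j, rfl⟩⟩
  have hC (β : Type) (t : L.Term β) (y : β → C) :
      ((t.realize y : C) : ∀ p, M p) = t.realize fun b => (y b : ∀ p, M p) :=
    (HomClass.realize_term C.subtype (t := t) (v := y)).symm
  have hCα (t : L.Term α) : ((t.realize g : C) : ∀ p, M p) = t.realize x :=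
    (HomClass.realize_term C.subtype (t := t) (v := g)).symm
  have hCfin : Finite C := by
    refine hfin C (fun e he y => Subtype.ext ?_) ?_
    · rw [hC, hC]
      funext p
      rw [realize_piStructure, realize_piStructure]
      exact hKE (M p) (hK p) e he _
    · exact (Substructure.fg_iff_structure_fg C).1
        (Substructure.fg_closure (Set.finite_range x))
  refine not_injective_infinite_finite (fun k : ℕ => ((q k).out.realize g : C)) ?_
  intro k l hkl
  by_contra hne
  apply ha ⟨(k, l), hne⟩
  have h := congrArg (fun c : C => (c : ∀ p, M p) ⟨(k, l), hne⟩) hkl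
  simp only [hCα] at h
  rwa [realize_piStructure, realize_piStructure] at h

/-- **Term interpolation in locally finite classes.**  Let `K` be a class of `L`-algebras
contained in a locally finite variety, and let `A ↦ f^A` assign to each member of `K` an
`n`-ary operation.  If every subalgebra of a finite direct product of members of `K` is
closed under the coordinatewise operation, then `f` is representable by an `L`-term in
`K`. -/
theorem representable_by_term_of_closed_under_products
    {L : FirstOrder.Language.{u, v}} (hL : ∀ k, IsEmpty (L.Relations k))
    (K : ∀ M : Type w, L.Structure M → Prop)
    (hvar : ∃ E : Set (Σ k : ℕ, L.Term (Fin k) × L.Term (Fin k)),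
      (∀ (M : Type w) [iM : L.Structure M], K M iM →
        ∀ e ∈ E, ∀ v : Fin e.1 → M, e.2.1.realize v = e.2.2.realize v) ∧
      (∀ (M : Type w) [iM : L.Structure M],
        (∀ e ∈ E, ∀ v : Fin e.1 → M, e.2.1.realize v = e.2.2.realize v) →
        Structure.FG L M → Finite M))
    {n : ℕ} (f : ∀ (M : Type w) (iM : L.Structure M), (Fin n → M) → M)
    (hclosed : ∀ (m : ℕ) (A : Fin m → Type w) (SA : ∀ i, L.Structure (A i)),
      (∀ i, K (A i) (SA i)) →
      letI : L.Structure (∀ i, A i) := piStructure A (S := SA)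
      ∀ (S : L.Substructure (∀ i, A i)) (x : Fin n → ∀ i, A i),
        (∀ j, x j ∈ S) → (fun i => f (A i) (SA i) fun j => x j i) ∈ S) :
    ∃ t : L.Term (Fin n), ∀ (M : Type w) [iM : L.Structure M], K M iM →
      ∀ a : Fin n → M, t.realize a = f M iM a := by
  obtain ⟨E, hKE, hfin⟩ := hvar
  have := finite_quotient_termSetoid K E hKE hfin (Fin n)
  obtain ⟨m, ⟨e⟩⟩ := Finite.exists_equiv_fin (Quotient (termSetoid K (Fin n)))
  by_contra! hno
  choose M S hK a ha using fun i : Fin m => hno (e.symm i).out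
  letI : L.Structure (∀ i, M i) := piStructure M
  let x : Fin n → ∀ i, M i := fun j i => a i j
  obtain ⟨t, ht⟩ := exists_term_of_mem_closure_range
    (hclosed m M S hK (Substructure.closure L (Set.range x)) x
      fun j => Substructure.subset_closure ⟨j, rfl⟩)
  let i := e (Quotient.mk _ t)
  apply ha i
  have hti := congrFun ht i
  rw [realize_piStructure] at hti
  rw [← hti]
  have hequiv : (termSetoid K (Fin n)) (e.symm i).out t := by
    rw [e.symm_apply_apply]
    exact Quotient.mk_out t
  exact hequiv (M i) (hK i) (a i)

end Statement18
end

section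
/- Let K be a class of algebras in an algebraic first-order language L, contained in a locally finite variety, and suppose there is an L-term M(x,y,z) which is a majority term for K, i.e. K ⊨ M(x,x,y) = M(x,y,x) = M(y,x,x) = x. Let A ↦ f^A be a map assigning to each A ∈ K an n-ary operation f^A : Aⁿ → A. Assume that for all A, B ∈ K and every subalgebra S ≤ A × B, the underlying set of S is closed under the coordinatewise operation f^A × f^B. Then there is an L-term t(x₁,…,xₙ) such that t^A = f^A for every A ∈ K. -/
namespace Statement19

open FirstOrder Language Structure

universe u v w

/-- The product `L`-structure on a product of `L`-structures: operations and relations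
are computed coordinatewise. -/
def piStructure {L : FirstOrder.Language.{u, v}} {ι : Type*} (M : ι → Type w)
    [S : ∀ i, L.Structure (M i)] : L.Structure (∀ i, M i) where
  funMap f x i := funMap f fun j => x j i
  RelMap r x := ∀ i, RelMap r fun j => x j i

/-- The product `L`-structure on a binary product `A × B` of `L`-structures. -/
def prodStructure {L : FirstOrder.Language.{u, v}} (A : Type w) (B : Type w)
    [L.Structure A] [L.Structure B] : L.Structure (A × B) where
  funMap f x := (funMap f fun j => (x j).1, funMap f fun j => (x j).2)
  RelMap r x := (RelMap r fun j => (x j).1) ∧ (RelMap r fun j => (x j).2)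

variable {L' : FirstOrder.Language.{u, v}}

/-- `ForallPu K P` : the property `P` holds of every member of `P_u(K)`, i.e. of every
ultraproduct of a family of members of the class `K` of `L'`-structures with respect to an
ultrafilter. -/
def ForallPu (K : ∀ M : Type w, L'.Structure M → Prop)
    (P : ∀ A : Type w, L'.Structure A → Prop) : Prop :=
  ∀ (ι : Type w) (u : Ultrafilter ι) (M : ι → Type w) (S : ∀ i, L'.Structure (M i)),
    (∀ i, K (M i) (S i)) →
    letI : ∀ i, L'.Structure (M i) := S
    P ((u : Filter ι).Product M) inferInstance

/-- `ForallPuPfin K P` : the property `P` holds of every member of `P_u(P_fin(K))`, i.e. of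
every ultraproduct (with respect to an ultrafilter) of a family of finite direct products
`A₁ × ⋯ × A_k` (`k ≥ 1`) of members of `K`. -/
def ForallPuPfin (K : ∀ M : Type w, L'.Structure M → Prop)
    (P : ∀ A : Type w, L'.Structure A → Prop) : Prop :=
  ∀ (ι : Type w) (u : Ultrafilter ι) (k : ι → ℕ), (∀ i, 0 < k i) →
    ∀ (N : ∀ i, Fin (k i) → Type w) (S : ∀ i j, L'.Structure (N i j)),
      (∀ i j, K (N i j) (S i j)) →
      letI : ∀ i, L'.Structure (∀ j, N i j) := fun i => piStructure (N i) (S := S i)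
      P ((u : Filter ι).Product fun i => ∀ j, N i j) inferInstance

variable {L : FirstOrder.Language.{u, v}}

/-- A finite conjunction of atomic formulas. -/
inductive IsConjAtomic {α : Type*} {k : ℕ} : L.BoundedFormula α k → Prop
  | of_isAtomic {θ : L.BoundedFormula α k} : θ.IsAtomic → IsConjAtomic θ
  | inf {θ₁ θ₂ : L.BoundedFormula α k} : IsConjAtomic θ₁ → IsConjAtomic θ₂ →
      IsConjAtomic (θ₁ ⊓ θ₂)

/-- A positive open formula: a finite disjunction of finite conjunctions of atomic
formulas. -/
inductive IsPositiveOpen {α : Type*} {k : ℕ} : L.BoundedFormula α k → Prop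
  | of_isConjAtomic {θ : L.BoundedFormula α k} : IsConjAtomic θ → IsPositiveOpen θ
  | sup {θ₁ θ₂ : L.BoundedFormula α k} : IsPositiveOpen θ₁ → IsPositiveOpen θ₂ →
      IsPositiveOpen (θ₁ ⊔ θ₂)

/-- A literal: an atomic or a negated atomic formula. -/
inductive IsLiteral {α : Type*} {k : ℕ} : L.BoundedFormula α k → Prop
  | of_isAtomic {θ : L.BoundedFormula α k} : θ.IsAtomic → IsLiteral θ
  | not_isAtomic {θ : L.BoundedFormula α k} : θ.IsAtomic → IsLiteral θ.not

/-- A finite conjunction of literals (atomic or negated atomic formulas). -/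
inductive IsConjLiteral {α : Type*} {k : ℕ} : L.BoundedFormula α k → Prop
  | of_isLiteral {θ : L.BoundedFormula α k} : IsLiteral θ → IsConjLiteral θ
  | inf {θ₁ θ₂ : L.BoundedFormula α k} : IsConjLiteral θ₁ → IsConjLiteral θ₂ →
      IsConjLiteral (θ₁ ⊓ θ₂)

/-- A Horn clause: a disjunction of atomic and negated atomic formulas containing at most
one non-negated atomic formula (written in the normal form `¬α₁ ∨ ⋯ ∨ ¬α_r ∨ λ` with `λ` a
literal). -/
inductive IsHornClause {α : Type*} {k : ℕ} : L.BoundedFormula α k → Prop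
  | of_isAtomic {θ : L.BoundedFormula α k} : θ.IsAtomic → IsHornClause θ
  | not_isAtomic {θ : L.BoundedFormula α k} : θ.IsAtomic → IsHornClause θ.not
  | sup_not {θ₁ θ₂ : L.BoundedFormula α k} : θ₁.IsAtomic → IsHornClause θ₂ →
      IsHornClause (θ₁.not ⊔ θ₂)

/-- An open Horn formula: a finite conjunction of Horn clauses. -/
inductive IsOpenHorn {α : Type*} {k : ℕ} : L.BoundedFormula α k → Prop
  | of_isHornClause {θ : L.BoundedFormula α k} : IsHornClause θ → IsOpenHorn θ
  | inf {θ₁ θ₂ : L.BoundedFormula α k} : IsOpenHorn θ₁ → IsOpenHorn θ₂ → IsOpenHorn (θ₁ ⊓ θ₂)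

/-- If correctness at a point is preserved by a ternary operation as soon as two of its arguments
are correct there, then correctness at pairs of points extends to finite sets of points. -/
theorem exists_forall_mem_finset_of_majority {τ P : Type*} [Nonempty τ] (C : τ → P → Prop)
    (m : τ → τ → τ → τ)
    (h₁₂ : ∀ p t₁ t₂ t₃, C t₁ p → C t₂ p → C (m t₁ t₂ t₃) p)
    (h₁₃ : ∀ p t₁ t₂ t₃, C t₁ p → C t₃ p → C (m t₁ t₂ t₃) p)
    (h₂₃ : ∀ p t₁ t₂ t₃, C t₂ p → C t₃ p → C (m t₁ t₂ t₃) p)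
    (hpair : ∀ p q, ∃ t, C t p ∧ C t q) (s : Finset P) : ∃ t, ∀ p ∈ s, C t p := by
  classical
  have key : ∀ s : Finset P, ∀ p q, ∃ t, C t p ∧ C t q ∧ ∀ x ∈ s, C t x := by
    intro s
    induction s using Finset.induction_on with
    | empty => simpa using hpair
    | insert r s _ ih =>
      intro p q
      obtain ⟨t₁, hp₁, hq₁, hs₁⟩ := ih p q
      obtain ⟨t₂, hp₂, hr₂, hs₂⟩ := ih p r
      obtain ⟨t₃, hq₃, hr₃, hs₃⟩ := ih q r
      refine ⟨m t₁ t₂ t₃, h₁₂ _ _ _ _ hp₁ hp₂, h₁₃ _ _ _ _ hq₁ hq₃, fun x hx => ?_⟩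
      rcases Finset.mem_insert.mp hx with rfl | hx
      · exact h₂₃ _ _ _ _ hr₂ hr₃
      · exact h₁₂ _ _ _ _ (hs₁ x hx) (hs₂ x hx)
  rcases s.eq_empty_or_nonempty with rfl | ⟨p, -⟩
  · exact ⟨Classical.arbitrary τ, by simp⟩
  · obtain ⟨t, -, -, ht⟩ := key s p p
    exact ⟨t, ht⟩

/-- In a product of structures, terms are evaluated coordinatewise. -/
theorem realize_piStructure {ι α : Type*} (M : ι → Type w) [S : ∀ i, L.Structure (M i)]
    (t : L.Term α) (v : α → ∀ i, M i) (i : ι) :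
    letI : L.Structure (∀ i, M i) := piStructure M
    t.realize v i = t.realize fun j => v j i := by
  let _ : L.Structure (∀ i, M i) := piStructure M
  let π : (∀ i, M i) →[L] M i := ⟨fun x => x i, fun _ _ => rfl, fun _ _ h => h i⟩
  exact (HomClass.realize_term π (t := t) (v := v)).symm

/-- In a binary product of structures, terms are evaluated coordinatewise. -/
theorem realize_prodStructure {α : Type*} (A B : Type w) [L.Structure A] [L.Structure B]
    (t : L.Term α) (v : α → A × B) :
    letI : L.Structure (A × B) := prodStructure A B
    t.realize v = (t.realize fun j => (v j).1, t.realize fun j => (v j).2) := by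
  let _ : L.Structure (A × B) := prodStructure A B
  let π₁ : (A × B) →[L] A := ⟨Prod.fst, fun _ _ => rfl, fun _ _ h => h.1⟩
  let π₂ : (A × B) →[L] B := ⟨Prod.snd, fun _ _ => rfl, fun _ _ h => h.2⟩
  exact Prod.ext (HomClass.realize_term π₁ (t := t) (v := v)).symm
    (HomClass.realize_term π₂ (t := t) (v := v)).symm

/-- An `n`-ary operation defined on all structures, including empty ones, forces the existence of
a term in `n` variables. -/
theorem nonempty_term_of_operation (hL : ∀ k, IsEmpty (L.Relations k)) {n : ℕ}
    (f : ∀ (M : Type w) (_ : L.Structure M), (Fin n → M) → M) : Nonempty (L.Term (Fin n)) := by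
  rcases n with _ | n
  · by_contra h
    have hc : IsEmpty (L.Functions 0) := ⟨fun c => h ⟨Term.func c Fin.elim0⟩⟩
    let S : L.Structure PEmpty.{w + 1} :=
      { funMap := fun {k} g x => match k, g, x with
          | 0, g, _ => hc.elim g
          | _ + 1, _, x => x 0
        RelMap := fun {k} r _ => (hL k).elim r }
    exact (f PEmpty S Fin.elim0).elim
  · exact ⟨Term.var 0⟩

/-- If every finitely generated structure satisfying a set `E` of equations is finite, then the
terms in `n` variables take only finitely many values at a tuple in a product of models of `E`. -/
theorem finite_range_realize_pi (E : Set (Σ k : ℕ, L.Term (Fin k) × L.Term (Fin k)))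
    (hfin : ∀ (M : Type w) [L.Structure M],
      (∀ e ∈ E, ∀ v : Fin e.1 → M, e.2.1.realize v = e.2.2.realize v) →
      Structure.FG L M → Finite M)
    {ι : Type} {n : ℕ} (M : ι → Type w) [S : ∀ i, L.Structure (M i)]
    (hE : ∀ i, ∀ e ∈ E, ∀ v : Fin e.1 → M i, e.2.1.realize v = e.2.2.realize v)
    (a : ∀ i, Fin n → M i) :
    (Set.range fun (t : L.Term (Fin n)) i => t.realize (a i)).Finite := by
  let _ : L.Structure (∀ i, M i) := piStructure M
  let g : Fin n → ∀ i, M i := fun j i => a i j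
  let N : L.Substructure (∀ i, M i) := Substructure.closure L (Set.range g)
  have hN : Finite N := by
    refine hfin N (fun e he v => ?_) ?_
    · apply Subtype.ext
      have h (t : L.Term (Fin e.1)) : (t.realize v).1 = t.realize fun j => (v j).1 :=
        (HomClass.realize_term N.subtype (t := t) (v := v)).symm
      rw [h, h]
      funext i
      rw [realize_piStructure, realize_piStructure]
      exact hE i e he _
    · exact (Substructure.fg_iff_structure_fg N).mp (Substructure.fg_closure (Set.finite_range g))
  refine (Set.toFinite (N : Set (∀ i, M i))).subset ?_
  rintro _ ⟨t, rfl⟩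
  have h : (fun i => t.realize (a i)) = t.realize g := by
    funext i
    exact (realize_piStructure M t g i).symm
  change (fun i => t.realize (a i)) ∈ N
  rw [h]
  exact t.realize_mem _ fun j => Substructure.subset_closure (Set.mem_range_self j)

/-- A member of the class `K` together with an `n`-tuple of its elements. -/
structure PointedMember (K : ∀ M : Type w, L.Structure M → Prop) (n : ℕ) where
  /-- the underlying set -/
  carrier : Type w
  /-- the operations -/
  [str : L.Structure carrier]
  /-- membership in the class -/
  mem : K carrier str
  /-- the chosen tuple -/
  tuple : Fin n → carrier

attribute [instance] PointedMember.str

/-- **Baker–Pixley theorem for locally finite classes with a majority term.**  Let `K` be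
a class of `L`-algebras contained in a locally finite variety and having a majority term.
If for all `A, B ∈ K` every subalgebra of `A × B` is closed under `f^A × f^B`, then `f` is
representable by an `L`-term in `K`. -/
theorem representable_by_term_of_majority_term
    {L : FirstOrder.Language.{u, v}} (hL : ∀ k, IsEmpty (L.Relations k))
    (K : ∀ M : Type w, L.Structure M → Prop)
    (hvar : ∃ E : Set (Σ k : ℕ, L.Term (Fin k) × L.Term (Fin k)),
      (∀ (M : Type w) [iM : L.Structure M], K M iM →
        ∀ e ∈ E, ∀ v : Fin e.1 → M, e.2.1.realize v = e.2.2.realize v) ∧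
      (∀ (M : Type w) [iM : L.Structure M],
        (∀ e ∈ E, ∀ v : Fin e.1 → M, e.2.1.realize v = e.2.2.realize v) →
        Structure.FG L M → Finite M))
    (hmaj : ∃ Mt : L.Term (Fin 3), ∀ (M : Type w) [iM : L.Structure M], K M iM →
      ∀ x y : M, Mt.realize ![x, x, y] = x ∧ Mt.realize ![x, y, x] = x ∧
        Mt.realize ![y, x, x] = x)
    {n : ℕ} (f : ∀ (M : Type w) (iM : L.Structure M), (Fin n → M) → M)
    (hclosed : ∀ (A : Type w) (iA : L.Structure A), K A iA →
      ∀ (B : Type w) (iB : L.Structure B), K B iB →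
        letI := iA
        letI := iB
        letI : L.Structure (A × B) := prodStructure A B
        ∀ (S : L.Substructure (A × B)) (x : Fin n → A × B),
          (∀ j, x j ∈ S) → (f A iA fun j => (x j).1, f B iB fun j => (x j).2) ∈ S) :
    ∃ t : L.Term (Fin n), ∀ (M : Type w) [iM : L.Structure M], K M iM →
      ∀ a : Fin n → M, t.realize a = f M iM a := by
  obtain ⟨E, hKE, hfin⟩ := hvar
  obtain ⟨Mt, hMt⟩ := hmaj
  have := nonempty_term_of_operation hL f
  let C : L.Term (Fin n) → PointedMember K n → Prop :=
    fun t p => t.realize p.tuple = f p.carrier p.str p.tuple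
  let m (t₁ t₂ t₃ : L.Term (Fin n)) : L.Term (Fin n) := Mt.subst ![t₁, t₂, t₃]
  have hm (t₁ t₂ t₃) (p : PointedMember K n) : (m t₁ t₂ t₃).realize p.tuple =
      Mt.realize ![t₁.realize p.tuple, t₂.realize p.tuple, t₃.realize p.tuple] := by
    rw [Term.realize_subst]
    congr 1
    funext i
    fin_cases i <;> rfl
  have hpair (p q : PointedMember K n) : ∃ t, C t p ∧ C t q := by
    let _ : L.Structure (p.carrier × q.carrier) := prodStructure p.carrier q.carrier
    let x : Fin n → p.carrier × q.carrier := fun j => (p.tuple j, q.tuple j)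
    have h := hclosed p.carrier p.str p.mem q.carrier q.str q.mem
      (Substructure.closure L (Set.range x)) x
      fun j => Substructure.subset_closure (Set.mem_range_self j)
    rw [← SetLike.mem_coe, Substructure.coe_closure_eq_range_term_realize] at h
    obtain ⟨t, ht⟩ := h
    choose k hk using fun y : Set.range x => y.2
    refine ⟨t.relabel k, ?_⟩
    have hx : (t.relabel k).realize x = t.realize ((↑) : Set.range x → _) := by
      rw [Term.realize_relabel]
      congr 1
      funext y
      exact hk y
    rw [← hx, realize_prodStructure] at ht
    exact Prod.ext_iff.mp ht
  have hfinset : ∀ s : Finset (PointedMember K n), ∃ t, ∀ p ∈ s, C t p := by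
    refine exists_forall_mem_finset_of_majority C m ?_ ?_ ?_ hpair
    all_goals
      intro p t₁ t₂ t₃ h h'
      simp only [C] at h h' ⊢
      rw [hm, h, h']
    · exact (hMt p.carrier p.mem _ _).1
    · exact (hMt p.carrier p.mem _ _).2.1
    · exact (hMt p.carrier p.mem _ _).2.2
  by_contra! hcon
  classical
  obtain ⟨s, hs, hlt⟩ := exists_seq_of_forall_finset_exists
    (fun y : L.Term (Fin n) × PointedMember K n => ¬ C y.1 y.2) (fun x y => C y.1 x.2) (by
      intro F _
      obtain ⟨t, ht⟩ := hfinset (F.image Prod.snd)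
      obtain ⟨M, iM, hM, a, ha⟩ := hcon t
      exact ⟨(t, ⟨M, hM, a⟩), ha, fun x hx => ht _ (Finset.mem_image_of_mem _ hx)⟩)
  have hrange := finite_range_realize_pi E hfin (fun i => (s i).2.carrier)
    (fun i => hKE _ (s i).2.mem) fun i => (s i).2.tuple
  obtain ⟨i, j, hij, heq⟩ := Set.Finite.exists_lt_map_eq_of_forall_mem
    (f := fun k i => (s k).1.realize (s i).2.tuple) (fun k => Set.mem_range_self (s k).1) hrange
  exact hs i ((congrFun heq i).trans (hlt i j hij))

end Statement19
end
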